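/- For every integer S ≥ 1, the number of pairs (m, k) of nonnegative integers with T_m - T_k = S equals the number of odd positive divisors of 2S. -/

import Mathlib

/-- The triangular number `T m = m(m+1)/2`. -/
def T (m : ℕ) : ℕ := m * (m + 1) / 2

theorem two_mul_T (m : ℕ) : 2 * T m = m * (m + 1) :=
  Nat.mul_div_cancel' (Nat.even_mul_succ_self m).two_dvd

/-- A difference of triangular numbers factors: `2 (T (k + a) - T k) = a (2 k + a + 1)`. -/
theorem T_add_eq_T_iff (S k a : ℕ) :
    T k + S = T (k + a) ↔ a * (2 * k + a + 1) = 2 * S := by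
  have hk := two_mul_T k
  have hm := two_mul_T (k + a)
  have expand : (k + a) * (k + a + 1) = k * (k + 1) + a * (2 * k + a + 1) := by ring
  omega

theorem exists_add_of_T_add_eq_T {S m k : ℕ} (hS : 1 ≤ S) (h : T k + S = T m) :
    ∃ a, m = k + a ∧ a * (2 * k + a + 1) = 2 * S := by
  have hkm : k ≤ m := by
    by_contra! hlt
    have hmono : T m ≤ T k := Nat.div_le_div_right (by gcongr)
    omega
  obtain ⟨a, rfl⟩ := Nat.exists_eq_add_of_le hkm
  exact ⟨a, rfl, (T_add_eq_T_iff S k a).1 h⟩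

/-- The odd one among the two factors `m - k` and `m + k + 1`. -/
def oddFactor (p : ℕ × ℕ) : ℕ :=
  if Odd (p.1 - p.2) then p.1 - p.2 else p.1 + p.2 + 1

theorem oddFactor_add (k a : ℕ) :
    oddFactor (k + a, k) = if Odd a then a else 2 * k + a + 1 := by
  simp only [oddFactor, Nat.add_sub_cancel_left]
  split_ifs <;> omega

/-- For every `S ≥ 1`, the number of pairs `(m, k)` of nonnegative integers
with `T m - T k = S` equals the number of odd positive divisors of `2S`. -/
theorem count_triangular_differences (S : ℕ) (hS : 1 ≤ S) :
    {p : ℕ × ℕ | T p.2 + S = T p.1}.ncard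
      = ((2 * S).divisors.filter (fun d => Odd d)).card := by
  rw [← Set.ncard_coe_finset]
  refine Set.ncard_congr (fun p _ => oddFactor p) ?_ ?_ ?_
  · rintro ⟨m, k⟩ h
    obtain ⟨a, rfl, ha⟩ := exists_add_of_T_add_eq_T (m := m) (k := k) hS h
    simp only [oddFactor_add, Finset.coe_filter, Nat.mem_divisors, Set.mem_ofPred_eq]
    split_ifs with hodd
    · exact ⟨⟨Dvd.intro _ ha, by omega⟩, hodd⟩
    · refine ⟨⟨Dvd.intro_left _ ha, by omega⟩, ?_⟩
      grind
  · rintro ⟨m, k⟩ ⟨m', k'⟩ h h' heq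
    obtain ⟨a, rfl, ha⟩ := exists_add_of_T_add_eq_T (m := m) (k := k) hS h
    obtain ⟨b, rfl, hb⟩ := exists_add_of_T_add_eq_T (m := m') (k := k') hS h'
    have hpos : 0 < a := Nat.pos_of_ne_zero (by rintro rfl; omega)
    have hpos' : 0 < b := Nat.pos_of_ne_zero (by rintro rfl; omega)
    rw [← hb] at ha
    simp only [oddFactor_add] at heq
    simp only [Prod.mk.injEq]
    split_ifs at heq
    · subst heq
      have := Nat.eq_of_mul_eq_mul_left hpos ha
      omega
    · rw [← heq, mul_comm b] at ha
      have := Nat.eq_of_mul_eq_mul_left hpos ha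
      omega
    · rw [heq, mul_comm b] at ha
      have := Nat.eq_of_mul_eq_mul_right hpos' ha
      omega
    · rw [heq] at ha
      have := Nat.eq_of_mul_eq_mul_right (by omega) ha
      omega
  · intro d hd
    simp only [Finset.coe_filter, Nat.mem_divisors, Set.mem_ofPred_eq] at hd
    obtain ⟨⟨⟨e, he⟩, -⟩, hodd⟩ := hd
    have heven : Even e := by
      have : Even (d * e) := he ▸ even_two_mul S
      exact (Nat.even_mul.1 this).resolve_left (Nat.not_even_iff_odd.2 hodd)
    rcases lt_or_ge d e with hlt | hge
    · obtain ⟨k, hk⟩ : ∃ k, e = 2 * k + d + 1 := ⟨(e - d - 1) / 2, by grind⟩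
      refine ⟨(k + d, k), (T_add_eq_T_iff S k d).2 (by rw [← hk, he]), ?_⟩
      rw [oddFactor_add, if_pos hodd]
    · obtain ⟨k, hk⟩ : ∃ k, d = 2 * k + e + 1 := ⟨(d - e - 1) / 2, by grind⟩
      refine ⟨(k + e, k), (T_add_eq_T_iff S k e).2 (by rw [← hk, he, mul_comm]), ?_⟩
      rw [oddFactor_add, if_neg (Nat.not_odd_iff_even.2 heven), hk]
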